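/- arXiv:2103.07518 — 12 statements merged into one kernel-verified Lean document; each statement's English description precedes it below -/
import Mathlib

section
/- Let p : ℕ → ℝ be a summable sequence with pᵢ ≥ 0 for all i and ∑ᵢ pᵢ ≤ 1. Then ∑ᵢ 3pᵢ²(1 − pᵢ) ≤ 3/4. (This is the analytic core of Proposition 1.1: for the number K₃ of distinct values among the first 3 terms of an i.i.d. sequence whose atom weights are (pᵢ), the quantity ∑ᵢ 3pᵢ²(1 − pᵢ) equals P(K₃ = 2), and the bound extends to infinite exchangeable sequences by de Finetti mixing.) -/
theorem q2_le_three_quarters (p : ℕ → ℝ) (hsum : Summable p)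
    (hnn : ∀ i, 0 ≤ p i) (hle : ∑' i, p i ≤ 1) :
    ∑' i, 3 * p i ^ 2 * (1 - p i) ≤ 3 / 4 := by
  have hp_le_one (i : ℕ) : p i ≤ 1 := (hsum.le_tsum i fun j _ => hnn j).trans hle
  have hterm_nonneg (i : ℕ) : 0 ≤ 3 * p i ^ 2 * (1 - p i) :=
    mul_nonneg (by positivity) (sub_nonneg.mpr (hp_le_one i))
  have hterm_le (i : ℕ) : 3 * p i ^ 2 * (1 - p i) ≤ 3 / 4 * p i := by
    nlinarith [mul_nonneg (hnn i) (sq_nonneg (2 * p i - 1))]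
  have hsum' : Summable fun i => 3 / 4 * p i := hsum.mul_left _
  calc ∑' i, 3 * p i ^ 2 * (1 - p i)
      ≤ ∑' i, 3 / 4 * p i :=
        (Summable.of_nonneg_of_le hterm_nonneg hterm_le hsum').tsum_le_tsum hterm_le hsum'
    _ = 3 / 4 * ∑' i, p i := tsum_mul_left
    _ ≤ 3 / 4 := by linarith
end

section
/- Let S ⊆ ℝ² be the set S = {(1/N², (N−1)(N−2)/N²) : N ∈ ℕ, N ≥ 1} ∪ {(0,1)}. Then the set of extreme points of the convex hull of S is exactly S. (This is Theorem 1.3(i) expressed in the coordinates (q₁, q₃), since a probability distribution (q₁,q₂,q₃) of K₃ is determined by the pair (q₁,q₃).) -/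
/-- A point of `s` at which a linear functional attains its strict minimum over `s` is an extreme
point of the convex hull of `s`. -/
theorem mem_extremePoints_convexHull_of_forall_lt {E : Type*} [AddCommGroup E] [Module ℝ E]
    {s : Set E} {x : E} (hx : x ∈ s) (f : E →ₗ[ℝ] ℝ) (h : ∀ y ∈ s, y ≠ x → f x < f y) :
    x ∈ (convexHull ℝ s).extremePoints ℝ := by
  have hconv : Convex ℝ {y | y = x ∨ f x < f y} := by
    rw [convex_iff_forall_pos]
    intro y hy z hz a b ha hb hab
    have hfx : f x = a * f x + b * f x := by rw [← add_mul, hab, one_mul]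
    simp only [Set.mem_ofPred_eq, map_add, map_smul, smul_eq_mul] at hy hz ⊢
    rcases hy with rfl | hy <;> rcases hz with rfl | hz
    · exact .inl (Convex.combo_self hab _)
    all_goals right; nlinarith
  have hhull : convexHull ℝ s ⊆ {y | y = x ∨ f x < f y} :=
    convexHull_min (fun y hy ↦ or_iff_not_imp_left.2 (h y hy)) hconv
  rw [(convex_convexHull ℝ s).mem_extremePoints_iff_mem_sdiff_convexHull_sdiff]
  refine ⟨subset_convexHull ℝ s hx, fun hmem ↦ ?_⟩
  have hlt : x ∈ {y | f x < f y} :=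
    convexHull_min (fun y hy ↦ (hhull hy.1).resolve_left hy.2)
      (convex_halfSpace_gt f.isLinear (f x)) hmem
  exact lt_irrefl (f x) (by simpa only [Set.mem_ofPred_eq] using hlt)

/-- The point of a parabola with parameter `c > 0` strictly minimizes the functional
`(u, v) ↦ v + (3 / (2 * c) - 2) * u` along the parabola. -/
theorem parabola_functional_lt {c t : ℝ} (hc : 0 < c) (ht : t ≠ c) :
    1 - 3 * c + 2 * c ^ 2 + (3 / (2 * c) - 2) * c ^ 2 <
      1 - 3 * t + 2 * t ^ 2 + (3 / (2 * c) - 2) * t ^ 2 := by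
  have hpos : 0 < 3 / (2 * c) * (t - c) ^ 2 := by
    have := sub_ne_zero.2 ht
    positivity
  have hid : 1 - 3 * t + 2 * t ^ 2 + (3 / (2 * c) - 2) * t ^ 2 -
      (1 - 3 * c + 2 * c ^ 2 + (3 / (2 * c) - 2) * c ^ 2) = 3 / (2 * c) * (t - c) ^ 2 := by
    field_simp
    ring
  linarith

/-- The points of the theorem lie on a parabola with parameter `1 / N`. -/
theorem point_eq_parabola {N : ℕ} (hN : 1 ≤ N) :
    ((1 / (N : ℝ) ^ 2, ((N : ℝ) - 1) * ((N : ℝ) - 2) / (N : ℝ) ^ 2) : ℝ × ℝ) =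
      (((N : ℝ)⁻¹) ^ 2, 1 - 3 * (N : ℝ)⁻¹ + 2 * ((N : ℝ)⁻¹) ^ 2) := by
  have : (N : ℝ) ≠ 0 := by positivity
  ext <;> simp only <;> field_simp
  ring

theorem extremePoints_convexHull_V3 :
    (convexHull ℝ {x : ℝ × ℝ |
        (∃ N : ℕ, 1 ≤ N ∧
          x = (1 / (N : ℝ) ^ 2, ((N : ℝ) - 1) * ((N : ℝ) - 2) / (N : ℝ) ^ 2)) ∨
        x = (0, 1)}).extremePoints ℝ =
      {x : ℝ × ℝ |
        (∃ N : ℕ, 1 ≤ N ∧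
          x = (1 / (N : ℝ) ^ 2, ((N : ℝ) - 1) * ((N : ℝ) - 2) / (N : ℝ) ^ 2)) ∨
        x = (0, 1)} := by
  refine extremePoints_convexHull_subset.antisymm fun x hx ↦ ?_
  rcases id hx with ⟨N, hN, rfl⟩ | rfl
  · refine mem_extremePoints_convexHull_of_forall_lt hx
      (LinearMap.snd ℝ ℝ ℝ + (3 / (2 * (N : ℝ)⁻¹) - 2) • LinearMap.fst ℝ ℝ ℝ) fun y hy hne ↦ ?_
    have hc : 0 < (N : ℝ)⁻¹ := by positivity
    rw [point_eq_parabola hN] at hne ⊢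
    obtain ⟨t, rfl⟩ : ∃ t : ℝ, y = (t ^ 2, 1 - 3 * t + 2 * t ^ 2) := by
      rcases hy with ⟨M, hM, rfl⟩ | rfl
      · exact ⟨_, point_eq_parabola hM⟩
      · exact ⟨0, by norm_num⟩
    have hlt := parabola_functional_lt hc (t := t) (by rintro rfl; exact hne rfl)
    simpa only [LinearMap.add_apply, LinearMap.smul_apply, LinearMap.fst_apply,
      LinearMap.snd_apply, smul_eq_mul] using hlt
  · refine mem_extremePoints_convexHull_of_forall_lt hx (LinearMap.fst ℝ ℝ ℝ) fun y hy hne ↦ ?_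
    obtain ⟨N, hN, rfl⟩ := hy.resolve_right hne
    simp only [LinearMap.fst_apply]
    positivity
end

section
/- Let p : ℕ → ℝ be a summable sequence with pᵢ ≥ 0 for all i and ∑ᵢ pᵢ ≤ 1. Then the point (∑ᵢ pᵢ³, 1 − ∑ᵢ (3pᵢ² − 2pᵢ³)) in ℝ² belongs to the convex hull of the set S = {(1/N², (N−1)(N−2)/N²) : N ∈ ℕ, N ≥ 1} ∪ {(0,1)}. (This is Theorem 1.3(ii) for i.i.d. sequences: the law of K₃ for any i.i.d. sequence lies in conv(V₃); the general exchangeable case follows by de Finetti mixing.) -/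
open Finset in
/-- Replacing two coordinates of `p` changes a sum of values of `f` only at these coordinates. -/
theorem sum_comp_update_update {ι : Type*} [Fintype ι] [DecidableEq ι] (p : ι → ℝ) (f : ℝ → ℝ)
    {i j : ι} (hij : i ≠ j) (x y : ℝ) :
    ∑ k, f (Function.update (Function.update p i x) j y k) =
      ∑ k, f (p k) - f (p i) - f (p j) + f x + f y := by
  have hj : j ∈ univ.erase i := by simp [hij.symm]
  rw [← add_sum_erase univ _ (mem_univ i), ← add_sum_erase (univ.erase i) _ hj,
    ← add_sum_erase univ (fun k => f (p k)) (mem_univ i),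
    ← add_sum_erase (univ.erase i) (fun k => f (p k)) hj]
  have hrest : ∑ k ∈ (univ.erase i).erase j,
      f (Function.update (Function.update p i x) j y k) =
        ∑ k ∈ (univ.erase i).erase j, f (p k) := by
    refine sum_congr rfl fun k hk => ?_
    simp only [mem_erase] at hk
    rw [Function.update_of_ne hk.1, Function.update_of_ne hk.2.1]
  rw [hrest, Function.update_of_ne hij, Function.update_self, Function.update_self]
  ring

/-- The case of `m` equal masses `t` of the lower bound on the power sums. -/
theorem uniform_cubic_nonneg (N m : ℕ) {t : ℝ} (ht : 0 ≤ t) (hmt : m * t ≤ 1) :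
    0 ≤ (N : ℝ) * (N + 1) * (m * t ^ 3) - (2 * N + 1) * (m * t ^ 2) + 1 := by
  have hN : (0 : ℝ) ≤ N := N.cast_nonneg
  have hm : (0 : ℝ) ≤ m := m.cast_nonneg
  set D : ℝ := (2 * N + 1) - N * (N + 1) * t with hD
  have key : (N : ℝ) * (N + 1) * (m * t ^ 3) - (2 * N + 1) * (m * t ^ 2) + 1
      = 1 - m * t * (t * D) := by rw [hD]; ring
  rw [key]
  rcases le_total D 0 with h0 | h0
  · have : m * t * (t * D) ≤ 0 :=
      mul_nonpos_of_nonneg_of_nonpos (by positivity) (mul_nonpos_of_nonneg_of_nonpos ht h0)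
    linarith
  by_cases hmid : 1 < (N + 1) * t ∧ N * t < 1
  · obtain ⟨h1, h2⟩ := hmid
    have hmN : m ≤ N := by
      by_contra! h
      have : (N : ℝ) + 1 ≤ m := by exact_mod_cast h
      nlinarith
    have hmN' : (m : ℝ) ≤ N := by exact_mod_cast hmN
    have hle : m * (t * (t * D)) ≤ N * (t * (t * D)) :=
      mul_le_mul_of_nonneg_right hmN' (by positivity)
    have hfac : 1 - N * (t * (t * D)) =
        (1 - N * t) * (1 + N * t - N * t * (N * t) - N * t * t) := by rw [hD]; ring
    have hNt : 0 ≤ N * t := by positivity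
    have htt : N * t * t ≤ N * t := by
      rcases Nat.eq_zero_or_pos N with rfl | hpos
      · simp
      · have : (1 : ℝ) ≤ N := by exact_mod_cast hpos
        exact mul_le_of_le_one_right hNt (by nlinarith)
    have hprod : 0 ≤ (1 - N * t) * (1 + N * t - N * t * (N * t) - N * t * t) :=
      mul_nonneg (by linarith) (by nlinarith)
    nlinarith
  · have hfac : 1 - t * D = (1 - N * t) * (1 - (N + 1) * t) := by rw [hD]; ring
    have hprod : 0 ≤ (1 - N * t) * (1 - (N + 1) * t) := by
      rcases not_and_or.1 hmid with h | h
      · exact mul_nonneg (by nlinarith) (by linarith)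
      · exact mul_nonneg_of_nonpos_of_nonpos (by linarith) (by nlinarith)
    have : m * t * (t * D) ≤ 1 * (t * D) := mul_le_mul_of_nonneg_right hmt (by positivity)
    linarith

open Finset in
/-- The lower bound on the third power sum of a finite family of masses in terms of the second. -/
theorem power_sum_bound {ι : Type*} [Fintype ι] (N : ℕ) (p : ι → ℝ)
    (hnn : ∀ i, 0 ≤ p i) (hle : ∑ i, p i ≤ 1) :
    0 ≤ (N : ℝ) * (N + 1) * ∑ i, p i ^ 3 - (2 * N + 1) * ∑ i, p i ^ 2 + 1 := by
  classical
  set F : (ι → ℝ) → ℝ := fun q =>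
    (N : ℝ) * (N + 1) * ∑ i, q i ^ 3 - (2 * N + 1) * ∑ i, q i ^ 2 + 1 with hF
  set X : Set (ι → ℝ) := {q | (∀ i, 0 ≤ q i) ∧ ∑ i, q i ≤ 1} with hX
  have hXc : IsCompact X := by
    refine (isCompact_Icc (a := (0 : ι → ℝ)) (b := 1)).of_isClosed_subset ?_ ?_
    · rw [hX, Set.ofPred_and]
      refine IsClosed.inter ?_ (isClosed_le (by fun_prop) (by fun_prop))
      rw [Set.ofPred_forall]
      exact isClosed_iInter fun i => isClosed_le (by fun_prop) (by fun_prop)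
    · intro q hq
      exact ⟨hq.1, fun i => (single_le_sum (fun k _ => hq.1 k) (mem_univ i)).trans hq.2⟩
  obtain ⟨q₀, hq₀X, hq₀⟩ :=
    hXc.exists_isMinOn ⟨p, hnn, hle⟩ (f := F) (by fun_prop)
  -- among the minimizers, take one with the smallest support
  obtain ⟨q, ⟨hqX, hq⟩, hqmin⟩ :=
    exists_minimalFor_of_wellFoundedLT (fun q : ι → ℝ => q ∈ X ∧ ∀ r ∈ X, F q ≤ F r)
      (fun q => #{i | q i ≠ 0}) ⟨q₀, hq₀X, fun r hr => hq₀ hr⟩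
  have hmem : ∀ {i j : ι}, i ≠ j → ∀ x y : ℝ, 0 ≤ x → 0 ≤ y → x + y = q i + q j →
      Function.update (Function.update q i x) j y ∈ X := by
    intro i j hij x y hx hy hxy
    refine ⟨fun k => ?_, ?_⟩
    · simp only [Function.update_apply]
      split_ifs
      exacts [hy, hx, hqX.1 k]
    · have := sum_comp_update_update q id hij x y
      simp only [id] at this
      linarith [hqX.2]
  have hFup : ∀ {i j : ι}, i ≠ j → ∀ x y : ℝ, x + y = q i + q j →
      F (Function.update (Function.update q i x) j y) = F q +
        (2 * (2 * N + 1) - 3 * (N * (N + 1)) * (q i + q j)) * (x * y - q i * q j) := by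
    intro i j hij x y hxy
    have h2 := sum_comp_update_update q (· ^ 2) hij x y
    have h3 := sum_comp_update_update q (· ^ 3) hij x y
    obtain rfl : y = q i + q j - x := by linarith
    simp only [hF]
    rw [h2, h3]
    ring
  have heq : ∀ i j, q i ≠ 0 → q j ≠ 0 → q i = q j := by
    intro i j hi hj
    by_contra hne
    have hij : i ≠ j := fun h => hne (h ▸ rfl)
    have hi' := (hqX.1 i).lt_of_ne' hi
    have hj' := (hqX.1 j).lt_of_ne' hj
    have hprod := mul_pos hi' hj'
    have hmX := hmem hij (q i + q j) 0 (by linarith) le_rfl (by ring)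
    have hm := hFup hij (q i + q j) 0 (by ring)
    have he := hFup hij ((q i + q j) / 2) ((q i + q j) / 2) (by ring)
    have h1 := hq _ hmX
    have h2 := hq _ (hmem hij ((q i + q j) / 2) ((q i + q j) / 2)
      (by linarith) (by linarith) (by ring))
    rw [he] at h2
    have hsq : 0 < (q i - q j) ^ 2 := by
      have := sub_ne_zero.2 hne
      positivity
    set K := 2 * (2 * N + 1) - 3 * (N * (N + 1)) * (q i + q j) with hK
    have hK0 : K = 0 := by
      rw [hm] at h1
      apply le_antisymm
      · nlinarith
      · have : 0 ≤ K * (q i - q j) ^ 2 := by nlinarith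
        exact nonneg_of_mul_nonneg_left this hsq
    rw [hK0, zero_mul, add_zero] at hm
    have hlt : #{k | Function.update (Function.update q i (q i + q j)) j 0 k ≠ 0} <
        #{k | q k ≠ 0} := by
      refine card_lt_card ((ssubset_iff_of_subset ?_).2 ⟨j, by simpa using hj, by simp⟩)
      intro k hk
      simp only [mem_filter, mem_univ, true_and, Function.update_apply] at hk ⊢
      split_ifs at hk with h₁ h₂
      · exact absurd rfl hk
      · rwa [h₂]
      · exact hk
    exact (hqmin ⟨hmX, fun r hr => hm ▸ hq r hr⟩ hlt.le).not_gt hlt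
  refine le_trans ?_ (hq p ⟨hnn, hle⟩)
  obtain ⟨t, ht, hqt⟩ : ∃ t : ℝ, 0 ≤ t ∧ ∀ i, q i ≠ 0 → q i = t := by
    by_cases h : ∃ i, q i ≠ 0
    · obtain ⟨i, hi⟩ := h
      exact ⟨q i, hqX.1 i, fun k hk => heq k i hk hi⟩
    · push Not at h
      exact ⟨0, le_rfl, fun i _ => h i⟩
  have hsum : ∀ k : ℕ, k ≠ 0 → ∑ i, q i ^ k = #{i | q i ≠ 0} * t ^ k := by
    intro k hk
    rw [← nsmul_eq_mul, ← sum_const, sum_filter]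
    refine sum_congr rfl fun i _ => ?_
    split_ifs with h
    · rw [hqt i h]
    · rw [not_not.1 h, zero_pow hk]
  have h1 := hsum 1 one_ne_zero
  simp only [pow_one] at h1
  simp only [hF]
  rw [hsum 2 two_ne_zero, hsum 3 three_ne_zero]
  exact uniform_cubic_nonneg N _ ht (h1 ▸ hqX.2)

/-- A point on or above the chords of the parabola `b = a ^ 2` between consecutive reciprocals of
natural numbers, and on or below the diagonal, gives a point of the convex hull. -/
theorem mem_convexHull_of_chord_bounds {a b : ℝ} (hb : 0 ≤ b) (hba : b ≤ a) (ha : a ≤ 1)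
    (hchord : ∀ N : ℕ, 0 ≤ (N : ℝ) * (N + 1) * b - (2 * N + 1) * a + 1) :
    ((b, 1 - (3 * a - 2 * b)) : ℝ × ℝ) ∈
      convexHull ℝ {x : ℝ × ℝ |
        (∃ N : ℕ, 1 ≤ N ∧
          x = (1 / (N : ℝ) ^ 2, ((N : ℝ) - 1) * ((N : ℝ) - 2) / (N : ℝ) ^ 2)) ∨
        x = (0, 1)} := by
  set C := convexHull ℝ {x : ℝ × ℝ |
        (∃ N : ℕ, 1 ≤ N ∧
          x = (1 / (N : ℝ) ^ 2, ((N : ℝ) - 1) * ((N : ℝ) - 2) / (N : ℝ) ^ 2)) ∨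
        x = (0, 1)} with hC
  have hconv : Convex ℝ C := convex_convexHull ℝ _
  have hv : ∀ N : ℕ, 1 ≤ N →
      ((1 / (N : ℝ) ^ 2, ((N : ℝ) - 1) * ((N : ℝ) - 2) / (N : ℝ) ^ 2) : ℝ × ℝ) ∈ C :=
    fun N hN => subset_convexHull ℝ _ (Or.inl ⟨N, hN, rfl⟩)
  have h0 : ((0, 1) : ℝ × ℝ) ∈ C := subset_convexHull ℝ _ (Or.inr rfl)
  rcases (hb.trans hba).eq_or_lt with rfl | hapos
  · obtain rfl : b = 0 := le_antisymm hba hb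
    simpa using h0
  have hinv : 1 ≤ a⁻¹ := (one_le_inv₀ hapos).2 ha
  set N := ⌊a⁻¹⌋₊ with hNdef
  have hN1 : 1 ≤ N := Nat.le_floor (by simpa using hinv)
  have hN1' : (1 : ℝ) ≤ N := by exact_mod_cast hN1
  have hNa : N * a ≤ 1 := by
    have := Nat.floor_le (inv_nonneg.2 hapos.le)
    calc N * a ≤ a⁻¹ * a := mul_le_mul_of_nonneg_right this hapos.le
      _ = 1 := inv_mul_cancel₀ hapos.ne'
  have hNa' : 1 ≤ (N + 1) * a := by
    have := (Nat.lt_floor_add_one a⁻¹).le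
    calc 1 = a⁻¹ * a := (inv_mul_cancel₀ hapos.ne').symm
      _ ≤ (N + 1) * a := mul_le_mul_of_nonneg_right this hapos.le
  set c : ℝ := ((2 * N + 1) * a - 1) / (N * (N + 1)) with hc
  have hupper : ((a, 1 - (3 * a - 2 * a)) : ℝ × ℝ) ∈ C := by
    have := hconv (hv 1 le_rfl) h0 hapos.le (sub_nonneg.2 ha) (by ring)
    convert this using 1
    ext <;> simp
    ring
  have hlower : ((c, 1 - (3 * a - 2 * c)) : ℝ × ℝ) ∈ C := by
    have := hconv (hv N hN1) (hv (N + 1) (by omega))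
      (a := N * ((N + 1) * a - 1)) (b := (N + 1) * (1 - N * a))
      (mul_nonneg (by linarith) (by linarith)) (mul_nonneg (by linarith) (by linarith)) (by ring)
    convert this using 1
    ext <;> simp [hc] <;> field_simp <;> ring
  have hcb : c ≤ b := by
    rw [hc, div_le_iff₀ (by positivity)]
    linarith [hchord N]
  have hseg : b ∈ segment ℝ c a := by
    rw [segment_eq_Icc (hcb.trans hba)]
    exact ⟨hcb, hba⟩
  obtain ⟨u, v, hu, hv', huv, hb'⟩ := hseg
  have := hconv hlower hupper hu hv' huv
  convert this using 1
  simp only [smul_eq_mul] at hb'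
  obtain rfl : u = 1 - v := by linarith
  ext <;> simp <;> rw [← hb']
  ring

theorem lawK3_mem_convexHull (p : ℕ → ℝ) (hsum : Summable p)
    (hnn : ∀ i, 0 ≤ p i) (hle : ∑' i, p i ≤ 1) :
    ((∑' i, p i ^ 3, 1 - ∑' i, (3 * p i ^ 2 - 2 * p i ^ 3)) : ℝ × ℝ) ∈
      convexHull ℝ {x : ℝ × ℝ |
        (∃ N : ℕ, 1 ≤ N ∧
          x = (1 / (N : ℝ) ^ 2, ((N : ℝ) - 1) * ((N : ℝ) - 2) / (N : ℝ) ^ 2)) ∨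
        x = (0, 1)} := by
  have hp1 : ∀ i, p i ≤ 1 := fun i => (hsum.le_tsum i fun j _ => hnn j).trans hle
  have h21 : ∀ i, p i ^ 2 ≤ p i := fun i => pow_le_of_le_one (hnn i) (hp1 i) two_ne_zero
  have h32 : ∀ i, p i ^ 3 ≤ p i ^ 2 := fun i =>
    pow_le_pow_of_le_one (hnn i) (hp1 i) (by norm_num)
  have hs2 : Summable fun i => p i ^ 2 :=
    hsum.of_nonneg_of_le (fun i => pow_nonneg (hnn i) 2) h21
  have hs3 : Summable fun i => p i ^ 3 :=
    hs2.of_nonneg_of_le (fun i => pow_nonneg (hnn i) 3) h32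
  rw [(hs2.mul_left 3).tsum_sub (hs3.mul_left 2), tsum_mul_left, tsum_mul_left]
  refine mem_convexHull_of_chord_bounds (tsum_nonneg fun i => pow_nonneg (hnn i) 3)
    (hs3.tsum_le_tsum h32 hs2) ((hs2.tsum_le_tsum h21 hsum).trans hle) fun N => ?_
  refine ge_of_tendsto' (((hs3.hasSum.mul_left ((N : ℝ) * (N + 1))).sub
    (hs2.hasSum.mul_left (2 * (N : ℝ) + 1))).add_const 1) fun s => ?_
  have := power_sum_bound N (fun i : s => p i) (fun i => hnn i)
    ((s.sum_coe_sort p).trans_le ((hsum.sum_le_tsum s fun j _ => hnn j).trans hle))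
  rw [s.sum_coe_sort (fun i => p i ^ 3), s.sum_coe_sort (fun i => p i ^ 2)] at this
  simpa only [Finset.sum_sub_distrib, Finset.mul_sum] using this
end

section
/- Let k ≥ 1, let a, b ∈ ℝ and r : Fin k → ℝ satisfy 0 ≤ a ≤ b ≤ rᵢ for all i and a + b + ∑ᵢ rᵢ ≤ 1. Then 3(a+b)²(1−(a+b)) + ∑ᵢ 3rᵢ²(1−rᵢ) ≥ 3a²(1−a) + 3b²(1−b) + ∑ᵢ 3rᵢ²(1−rᵢ); that is, merging the two smallest atoms of a discrete distribution with at least 3 atoms does not decrease q₂. (Lemma 3.1.) -/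
theorem merge_not_decrease_q2 (k : ℕ) (hk : 1 ≤ k) (a b : ℝ) (r : Fin k → ℝ)
    (ha : 0 ≤ a) (hab : a ≤ b) (hbr : ∀ i, b ≤ r i)
    (hsum : a + b + ∑ i, r i ≤ 1) :
    3 * (a + b) ^ 2 * (1 - (a + b)) + ∑ i, 3 * r i ^ 2 * (1 - r i) ≥
      3 * a ^ 2 * (1 - a) + 3 * b ^ 2 * (1 - b) + ∑ i, 3 * r i ^ 2 * (1 - r i) := by
  have hb : 0 ≤ b := ha.trans hab
  have hr : r ⟨0, hk⟩ ≤ ∑ i, r i :=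
    Finset.single_le_sum (fun i _ => hb.trans (hbr i)) (Finset.mem_univ _)
  have h : 0 ≤ 2 - 3 * (a + b) := by linarith [hbr ⟨0, hk⟩]
  have key : 0 ≤ a * b * (2 - 3 * (a + b)) := mul_nonneg (mul_nonneg ha hb) h
  linarith
end

section
/- Let N ≥ 1 be a natural number, f(N) = 3N(N+1)/(2N+1), let p : Fin m → ℝ with pᵢ ≥ 0 and ∑ᵢ pᵢ < 1, and let ε be a real number with 0 < ε < min(3/f(N), 1 − ∑ᵢ pᵢ). Then 1 − 3(ε² + ∑ᵢ pᵢ²) + f(N)(ε³ + ∑ᵢ pᵢ³) < 1 − 3∑ᵢ pᵢ² + f(N)∑ᵢ pᵢ³. Consequently, L_N is not minimized over finite ranked discrete distributions at any distribution whose atom weights sum to strictly less than 1. (Lemma 3.4.) -/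
theorem LN_decreases_with_extra_atom (N : ℕ) (hN : 1 ≤ N) (m : ℕ) (p : Fin m → ℝ)
    (hnn : ∀ i, 0 ≤ p i) (hlt : ∑ i, p i < 1) (ε : ℝ)
    (hε0 : 0 < ε)
    (hε : ε < min (3 / (3 * (N : ℝ) * (N + 1) / (2 * N + 1))) (1 - ∑ i, p i)) :
    1 - 3 * (ε ^ 2 + ∑ i, p i ^ 2) +
        3 * (N : ℝ) * (N + 1) / (2 * N + 1) * (ε ^ 3 + ∑ i, p i ^ 3) <
      1 - 3 * ∑ i, p i ^ 2 + 3 * (N : ℝ) * (N + 1) / (2 * N + 1) * ∑ i, p i ^ 3 := by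
  have hN0 : (0 : ℝ) < N := by exact_mod_cast hN
  have hf : 0 < 3 * (N : ℝ) * (N + 1) / (2 * N + 1) := by positivity
  generalize 3 * (N : ℝ) * (N + 1) / (2 * N + 1) = f at *
  have hfε : ε * f < 3 := (lt_div_iff₀ hf).mp (hε.trans_le (min_le_left _ _))
  have hneg : ε ^ 2 * (ε * f - 3) < 0 := mul_neg_of_pos_of_neg (by positivity) (by linarith)
  linarith [hneg, show ε ^ 2 * (ε * f - 3) = f * ε ^ 3 - 3 * ε ^ 2 by ring,
    mul_add f (ε ^ 3) (∑ i, p i ^ 3)]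
end

section
/- Let N ≥ 1 be a natural number. Then for every m and every p : Fin m → ℝ with pᵢ ≥ 0 for all i and ∑ᵢ pᵢ ≤ 1, we have 1 − 3∑ᵢ pᵢ² + (3N(N+1)/(2N+1))·∑ᵢ pᵢ³ ≥ (2N−2)/(2N+1). (Lemma 3.2: geometrically, the point (q₁(p), q₃(p)) lies on or above every line joining v_N and v_{N+1}.) -/
/-- Changing two coordinates of `p` changes `∑ φ (p k)` only through the corresponding terms. -/
lemma sum_update_update {ι : Type*} [Fintype ι] [DecidableEq ι] (φ : ℝ → ℝ) (p : ι → ℝ)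
    {i j : ι} (hij : i ≠ j) (x y : ℝ) :
    ∑ k, φ (Function.update (Function.update p i x) j y k) =
      ∑ k, φ (p k) + (φ x - φ (p i)) + (φ y - φ (p j)) := by
  have h : ∑ k, (φ (Function.update (Function.update p i x) j y k) - φ (p k)) =
      (φ x - φ (p i)) + (φ y - φ (p j)) := by
    rw [Fintype.sum_eq_add i j hij]
    · simp [hij]
    · rintro k ⟨hi, hj⟩
      simp [hi, hj]
  rw [Finset.sum_sub_distrib] at h
  linarith

lemma isCompact_subprobability (m : ℕ) :
    IsCompact {p : Fin m → ℝ | (∀ i, 0 ≤ p i) ∧ ∑ i, p i ≤ 1} := by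
  refine (isCompact_Icc (a := (0 : Fin m → ℝ)) (b := 1)).of_isClosed_subset ?_ ?_
  · rw [Set.ofPred_and]
    refine IsClosed.inter ?_ (isClosed_le (by fun_prop) (by fun_prop))
    simp only [Set.ofPred_forall]
    exact isClosed_iInter fun i => isClosed_le (by fun_prop) (by fun_prop)
  · rintro p ⟨h0, h1⟩
    exact ⟨h0, fun i =>
      (Finset.single_le_sum (fun j _ => h0 j) (Finset.mem_univ i)).trans h1⟩

/-- The cubic bound for `m` equal masses `x`. -/
lemma cubic_nonneg_of_equal (N m : ℕ) (hN : 1 ≤ N) (x : ℝ) (hx : 0 ≤ x) (hmx : m * x ≤ 1) :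
    0 ≤ 1 - (2 * (N : ℝ) + 1) * (m * x ^ 2) + N * (N + 1) * (m * x ^ 3) := by
  have hN' : (1 : ℝ) ≤ N := by exact_mod_cast hN
  have key : 1 - (2 * (N : ℝ) + 1) * (m * x ^ 2) + N * (N + 1) * (m * x ^ 3) =
      1 - m * x * (x * ((2 * N + 1) - N * (N + 1) * x)) := by ring
  rw [key]
  have hm0 : 0 ≤ (m : ℝ) * x := by positivity
  rcases le_total (x * ((2 * N + 1) - N * (N + 1) * x)) 0 with h | h
  · nlinarith
  by_cases hout : 0 ≤ (1 - N * x) * (1 - (N + 1) * x)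
  · nlinarith
  · push Not at hout
    have hNx : (N : ℝ) * x < 1 := by
      by_contra! hc
      nlinarith
    have hNx' : 1 < ((N : ℝ) + 1) * x := by
      by_contra! hc
      nlinarith
    have hmN : (m : ℝ) ≤ N := by
      have : (m : ℝ) < N + 1 := by
        by_contra! hc
        nlinarith
      exact_mod_cast Nat.lt_succ_iff.mp (by exact_mod_cast this)
    have h1 : (m : ℝ) * x * (x * ((2 * N + 1) - N * (N + 1) * x)) ≤
        N * x * (x * ((2 * N + 1) - N * (N + 1) * x)) := by gcongr
    have h2 : 1 - (N : ℝ) * x * (x * ((2 * N + 1) - N * (N + 1) * x)) =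
        (1 - N * x) * (1 + N * x - N * (N + 1) * x ^ 2) := by ring
    have h3 : 0 ≤ 1 + (N : ℝ) * x - N * (N + 1) * x ^ 2 := by
      have hx1 : x ≤ 1 := by nlinarith
      have hxN := mul_nonneg hx (sub_nonneg.2 hNx.le)
      nlinarith [mul_nonneg hxN (zero_le_one.trans hN')]
    nlinarith [mul_nonneg (sub_nonneg.2 hNx.le) h3]

lemma cubic_nonneg (N : ℕ) (hN : 1 ≤ N) (m : ℕ) (p : Fin m → ℝ)
    (hnn : ∀ i, 0 ≤ p i) (hsum : ∑ i, p i ≤ 1) :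
    0 ≤ 1 - (2 * (N : ℝ) + 1) * ∑ i, p i ^ 2 + N * (N + 1) * ∑ i, p i ^ 3 := by
  induction m with
  | zero => simp
  | succ m ih =>
    have of_zero (q : Fin (m + 1) → ℝ) (hq : ∀ i, 0 ≤ q i) (hqs : ∑ i, q i ≤ 1)
        (i : Fin (m + 1)) (hi : q i = 0) :
        0 ≤ 1 - (2 * (N : ℝ) + 1) * ∑ i, q i ^ 2 + N * (N + 1) * ∑ i, q i ^ 3 := by
      simp only [Fin.sum_univ_succAbove _ i, hi] at hqs ⊢
      simpa using ih (fun k => q (i.succAbove k)) (fun k => hq _) (by simpa using hqs)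
    obtain ⟨q, ⟨hq, hqs⟩, hmin⟩ := (isCompact_subprobability (m + 1)).exists_isMinOn
      ⟨p, hnn, hsum⟩ (f := fun p =>
        1 - (2 * (N : ℝ) + 1) * ∑ i, p i ^ 2 + N * (N + 1) * ∑ i, p i ^ 3)
      (Continuous.continuousOn (by fun_prop))
    refine le_trans ?_ (hmin ⟨hnn, hsum⟩)
    by_cases hconst : ∀ i, q i = q 0
    · simp only [hconst, Finset.sum_const, Finset.card_univ, Fintype.card_fin,
        nsmul_eq_mul] at hqs ⊢
      exact cubic_nonneg_of_equal N (m + 1) hN (q 0) (hq 0) hqs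
    push Not at hconst
    obtain ⟨i, hi⟩ := hconst
    have hi0 : i ≠ 0 := fun h => hi (by rw [h])
    have update_nonneg (x y : ℝ) (hx : 0 ≤ x) (hy : 0 ≤ y) (k : Fin (m + 1)) :
        0 ≤ Function.update (Function.update q i x) 0 y k := by
      simp only [Function.update_apply]
      split_ifs <;> first | assumption | exact hq k
    have update_sum (x y : ℝ) (hxy : x + y = q i + q 0) :
        ∑ k, Function.update (Function.update q i x) 0 y k ≤ 1 := by
      have := sum_update_update id q hi0 x y
      simp only [id] at this
      linarith
    have h2 (x y : ℝ) := sum_update_update (fun t => t ^ 2) q hi0 x y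
    have h3 (x y : ℝ) := sum_update_update (fun t => t ^ 3) q hi0 x y
    rcases le_or_gt 0 (2 * (2 * (N : ℝ) + 1) - 3 * (N * (N + 1)) * (q i + q 0)) with hκ | hκ
    · have hmerge := of_zero _ (update_nonneg (q i + q 0) 0 (add_nonneg (hq i) (hq 0)) le_rfl)
        (update_sum _ _ (add_zero _)) 0 (by simp)
      rw [h2, h3] at hmerge
      nlinarith [mul_nonneg hκ (mul_nonneg (hq i) (hq 0))]
    · have hmid : 0 ≤ (q i + q 0) / 2 := by linarith [hq i, hq 0]
      have hequal := hmin ⟨update_nonneg _ _ hmid hmid, update_sum _ _ (add_halves _)⟩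
      simp only [Set.mem_ofPred_eq] at hequal
      rw [h2, h3] at hequal
      nlinarith [mul_pos_of_neg_of_neg hκ (neg_neg_of_pos (sq_pos_of_ne_zero (sub_ne_zero.2 hi)))]

theorem LN_lower_bound (N : ℕ) (hN : 1 ≤ N) (m : ℕ) (p : Fin m → ℝ)
    (hnn : ∀ i, 0 ≤ p i) (hsum : ∑ i, p i ≤ 1) :
    1 - 3 * ∑ i, p i ^ 2 + 3 * (N : ℝ) * (N + 1) / (2 * N + 1) * ∑ i, p i ^ 3 ≥
      (2 * (N : ℝ) - 2) / (2 * N + 1) := by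
  have h := cubic_nonneg N hN m p hnn hsum
  have hpos : (0 : ℝ) < 2 * N + 1 := by positivity
  rw [ge_iff_le, ← sub_nonneg]
  have key : 1 - 3 * ∑ i, p i ^ 2 + 3 * (N : ℝ) * (N + 1) / (2 * N + 1) * ∑ i, p i ^ 3 -
      (2 * (N : ℝ) - 2) / (2 * N + 1) =
      3 / (2 * N + 1) *
        (1 - (2 * (N : ℝ) + 1) * ∑ i, p i ^ 2 + N * (N + 1) * ∑ i, p i ^ 3) := by
    field_simp
    ring
  rw [key]
  exact mul_nonneg (by positivity) h
end

section
/- For every natural number N ≥ 1 (with real arithmetic), the slope of the line through the points v_N = (1/N², (N−1)(N−2)/N²) and v_{N+1} = (1/(N+1)², N(N−1)/(N+1)²) equals −(N−1)(3N+2)/(2N+1); that is, (N(N−1)/(N+1)² − (N−1)(N−2)/N²) / (1/(N+1)² − 1/N²) = −(N−1)(3N+2)/(2N+1). Moreover, the map N ↦ −(N−1)(3N+2)/(2N+1) is strictly decreasing in N for N ≥ 1. -/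
theorem slope_formula_and_decreasing :
    (∀ N : ℕ, 1 ≤ N →
      ((N : ℝ) * ((N : ℝ) - 1) / ((N : ℝ) + 1) ^ 2 -
          ((N : ℝ) - 1) * ((N : ℝ) - 2) / (N : ℝ) ^ 2) /
        (1 / ((N : ℝ) + 1) ^ 2 - 1 / (N : ℝ) ^ 2) =
        -(((N : ℝ) - 1) * (3 * N + 2) / (2 * N + 1))) ∧
    (∀ N M : ℕ, 1 ≤ N → N < M →
      -(((M : ℝ) - 1) * (3 * M + 2) / (2 * M + 1)) <
        -(((N : ℝ) - 1) * (3 * N + 2) / (2 * N + 1))) := by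
  refine ⟨fun N hN => ?_, fun N M hN hNM => ?_⟩
  · have hN' : (0 : ℝ) < N := by exact_mod_cast hN
    have hden : 1 / ((N : ℝ) + 1) ^ 2 - 1 / (N : ℝ) ^ 2 =
        -(2 * N + 1) / (((N : ℝ) + 1) ^ 2 * (N : ℝ) ^ 2) := by
      field_simp
      ring
    have hnum : (N : ℝ) * ((N : ℝ) - 1) / ((N : ℝ) + 1) ^ 2 -
          ((N : ℝ) - 1) * ((N : ℝ) - 2) / (N : ℝ) ^ 2 =
        ((N : ℝ) - 1) * (3 * N + 2) / (((N : ℝ) + 1) ^ 2 * (N : ℝ) ^ 2) := by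
      field_simp
      ring
    rw [hnum, hden, div_div_div_cancel_right₀ (by positivity), div_neg]
  · have hNM' : (N : ℝ) < M := by exact_mod_cast hNM
    rw [neg_lt_neg_iff, div_lt_div_iff₀ (by positivity) (by positivity), ← sub_pos]
    have hpos : 0 < ((M : ℝ) - N) * (6 * M * N + 3 * (M + N) + 3) :=
      mul_pos (sub_pos.mpr hNM') (by positivity)
    linarith
end

section
/- For all real numbers a, b > 0 and every natural number n ≥ 2, 4·((n−1)/n)·a·b·(a+b)^(n−2) ≤ (a+b)^n − a^n − b^n ≤ n·a·b·(a+b)^(n−2). (Lemma 4.2.) -/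
theorem Nat.choose_add_two_succ_mul (m k : ℕ) :
    (m + 2).choose (k + 1) * (k + 1) * (m + 1 - k) = (m + 2) * (m + 1) * m.choose k := by
  have h₁ := Nat.add_one_mul_choose_eq (m + 1) k
  have h₂ := Nat.choose_mul_succ_eq m k
  rw [← h₁, mul_assoc, ← h₂]
  ring

theorem choose_add_two_succ_bounds {m k : ℕ} (hk : k ≤ m) :
    4 * (((m : ℝ) + 1) / (m + 2)) * m.choose k ≤ (m + 2).choose (k + 1) ∧
      ((m + 2).choose (k + 1) : ℝ) ≤ (m + 2) * m.choose k := by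
  obtain ⟨j, rfl⟩ := Nat.exists_eq_add_of_le hk
  have h : ((k + j + 2).choose (k + 1) : ℝ) * (k + 1) * (j + 1) =
      (k + j + 2) * (k + j + 1) * (k + j).choose k := by
    have h := Nat.choose_add_two_succ_mul (k + j) k
    rw [show k + j + 1 - k = j + 1 by omega] at h
    exact_mod_cast h
  push_cast
  set c : ℝ := ((k + j).choose k : ℝ)
  have hc : 0 ≤ c := Nat.cast_nonneg _
  have hkj : (0 : ℝ) < (k + 1) * (j + 1) := by positivity
  have hC : ((k + j + 2).choose (k + 1) : ℝ) =
      (k + j + 2) * (k + j + 1) * c / ((k + 1) * (j + 1)) := by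
    rw [eq_div_iff hkj.ne', ← h, mul_assoc]
  rw [hC]
  constructor
  · rw [← mul_div_assoc, div_mul_eq_mul_div, div_le_div_iff₀ (by positivity) hkj]
    have hd : 0 ≤ ((k : ℝ) + j + 1) * c * ((k : ℝ) - j) ^ 2 := by positivity
    linarith
  · rw [div_le_iff₀ hkj]
    have hd : 0 ≤ ((k : ℝ) + j + 2) * c * (k * j) := by positivity
    linarith

theorem add_pow_add_two_sub_pow_sub_pow {R : Type*} [CommRing R] (a b : R) (m : ℕ) :
    (a + b) ^ (m + 2) - a ^ (m + 2) - b ^ (m + 2) =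
      ∑ k ∈ Finset.range (m + 1),
        ((m + 2).choose (k + 1) : R) * (a * b * (a ^ k * b ^ (m - k))) := by
  rw [add_pow, Finset.sum_range_succ, Finset.sum_range_succ']
  simp only [Nat.sub_self, pow_zero, Nat.choose_self, Nat.choose_zero_right, Nat.sub_zero,
    Nat.cast_one, mul_one, one_mul]
  rw [add_sub_cancel_right, add_sub_cancel_right]
  refine Finset.sum_congr rfl fun k hk => ?_
  have hkm : k ≤ m := Nat.lt_succ_iff.mp (Finset.mem_range.mp hk)
  rw [show m + 2 - (k + 1) = m - k + 1 by omega]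
  ring

theorem binom_power_bounds (a b : ℝ) (ha : 0 < a) (hb : 0 < b) (n : ℕ) (hn : 2 ≤ n) :
    4 * (((n : ℝ) - 1) / n) * a * b * (a + b) ^ (n - 2) ≤
        (a + b) ^ n - a ^ n - b ^ n ∧
      (a + b) ^ n - a ^ n - b ^ n ≤ (n : ℝ) * a * b * (a + b) ^ (n - 2) := by
  obtain ⟨m, rfl⟩ := Nat.exists_eq_add_of_le' hn
  have hsum (c : ℝ) : c * a * b * (a + b) ^ m =
      ∑ k ∈ Finset.range (m + 1), c * m.choose k * (a * b * (a ^ k * b ^ (m - k))) := by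
    rw [add_pow, Finset.mul_sum]
    exact Finset.sum_congr rfl fun k _ => by ring
  have hcast : ((m + 2 : ℕ) : ℝ) = m + 2 := by push_cast; rfl
  rw [Nat.add_sub_cancel, hcast, show (m : ℝ) + 2 - 1 = m + 1 by ring,
    add_pow_add_two_sub_pow_sub_pow, hsum, hsum]
  have hbounds {k : ℕ} (hk : k ∈ Finset.range (m + 1)) :=
    choose_add_two_succ_bounds (Nat.lt_succ_iff.mp (Finset.mem_range.mp hk))
  constructor
  · exact Finset.sum_le_sum fun k hk =>
      mul_le_mul_of_nonneg_right (hbounds hk).1 (by positivity)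
  · exact Finset.sum_le_sum fun k hk =>
      mul_le_mul_of_nonneg_right (hbounds hk).2 (by positivity)
end

section
/- Let n ≥ 3 be a natural number, let k ≥ 1, and let a, b ∈ ℝ and r : Fin k → ℝ satisfy 0 ≤ a ≤ b ≤ rᵢ for all i and a + b + ∑ᵢ rᵢ = 1. Define for a finite family (x₁,…,x_j) with ∑ xᵢ = 1 the quantity Q(x) = ∑_{i<j} ((xᵢ+xⱼ)^n − xᵢ^n − xⱼ^n). Then Q applied to the merged family (a+b, r₁, …, r_k) is at least Q applied to (a, b, r₁, …, r_k); that is, ∑ᵢ ((a+b+rᵢ)^n − (a+b)^n − rᵢ^n) ≥ ((a+b)^n − a^n − b^n) + ∑ᵢ ((a+rᵢ)^n − a^n − rᵢ^n) + ∑ᵢ ((b+rᵢ)^n − b^n − rᵢ^n). (Lemma 4.1: merging the two smallest atoms of a probability distribution with at least 3 atoms does not decrease q_{n,2}.) -/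
theorem two_mul_pow_add_pow_le_add_pow {x y : ℝ} (hx : 0 ≤ x) (hxy : x ≤ y) {n : ℕ}
    (hn : 2 ≤ n) : 2 * x ^ n + y ^ n ≤ (x + y) ^ n := by
  induction n, hn using Nat.le_induction with
  | base => nlinarith
  | succ n hn ih =>
    have hy : 0 ≤ y := hx.trans hxy
    have h1 := mul_le_mul_of_nonneg_left ih (add_nonneg hx hy)
    have h2 : 0 ≤ x * y ^ n := by positivity
    have h3 : 0 ≤ y * x ^ n := by positivity
    have h4 : 0 ≤ x ^ n * y := by positivity
    simp only [pow_succ]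
    nlinarith

/-- The multinomial mass of the words using all of `a`, `b`, `r` dominates that of the words
using exactly `a` and `b`, when `r` is the largest of the three. -/
theorem add_pow_sub_pow_sub_pow_le {a b r : ℝ} (ha : 0 ≤ a) (hab : a ≤ b) (hbr : b ≤ r) {n : ℕ}
    (hn : 3 ≤ n) :
    (a + b) ^ n - a ^ n - b ^ n ≤
      (a + b + r) ^ n - (a + b) ^ n - (a + r) ^ n - (b + r) ^ n + a ^ n + b ^ n + r ^ n := by
  have hb : 0 ≤ b := ha.trans hab
  have hr : 0 ≤ r := hb.trans hbr
  induction n, hn using Nat.le_induction with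
  | base =>
    have h : 0 ≤ a * b * (2 * r - a - b) := by
      apply mul_nonneg (mul_nonneg ha hb); linarith
    nlinarith
  | succ n hn ih =>
    have hab_n := two_mul_pow_add_pow_le_add_pow ha hab (show 2 ≤ n by omega)
    have har_n := two_mul_pow_add_pow_le_add_pow ha (hab.trans hbr) (show 2 ≤ n by omega)
    have hbr_n := two_mul_pow_add_pow_le_add_pow hb hbr (show 2 ≤ n by omega)
    have h1 := mul_le_mul_of_nonneg_left ih (add_nonneg (add_nonneg ha hb) hr)
    have h2 := mul_le_mul_of_nonneg_left hbr_n ha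
    have h3 := mul_le_mul_of_nonneg_left har_n hb
    have h4 := mul_le_mul_of_nonneg_left hab_n hr
    have h5 : 0 ≤ r * a ^ n := by positivity
    simp only [pow_succ]
    linarith

theorem merge_not_decrease_qn2 (n : ℕ) (hn : 3 ≤ n) (k : ℕ) (hk : 1 ≤ k)
    (a b : ℝ) (r : Fin k → ℝ) (ha : 0 ≤ a) (hab : a ≤ b) (hbr : ∀ i, b ≤ r i)
    (hsum : a + b + ∑ i, r i = 1) :
    ∑ i, ((a + b + r i) ^ n - (a + b) ^ n - r i ^ n) ≥
      ((a + b) ^ n - a ^ n - b ^ n) +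
        ∑ i, ((a + r i) ^ n - a ^ n - r i ^ n) +
        ∑ i, ((b + r i) ^ n - b ^ n - r i ^ n) := by
  have hD : 0 ≤ (a + b) ^ n - a ^ n - b ^ n := by
    have h := two_mul_pow_add_pow_le_add_pow ha hab (show 2 ≤ n by omega)
    have := pow_nonneg ha n
    linarith
  have hk' : (1 : ℝ) ≤ k := by exact_mod_cast hk
  have hkD := le_mul_of_one_le_left hD hk'
  have hS : ∑ i, (((a + b) ^ n - a ^ n - b ^ n) + ((a + r i) ^ n - a ^ n - r i ^ n) +
      ((b + r i) ^ n - b ^ n - r i ^ n)) ≤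
      ∑ i, ((a + b + r i) ^ n - (a + b) ^ n - r i ^ n) := by
    refine Finset.sum_le_sum fun i _ => ?_
    linarith [add_pow_sub_pow_sub_pow_le ha hab (hbr i) hn]
  rw [Finset.sum_add_distrib, Finset.sum_add_distrib, Finset.sum_const, Finset.card_univ,
    Fintype.card_fin, nsmul_eq_mul] at hS
  linarith
end

section
/- Let n ≥ 3 be a natural number and let x, y, z be nonnegative real numbers satisfying (C(n,2) + C(n,3))·x + (C(n,2)·(n−2) + 3·C(n,4))·y + (C(n,2) + n)·z ≤ 1, where C(n,k) denotes the binomial coefficient. Then C(n,2)·(x + (n−2)·y + z) ≤ max(4, n−1)/(n+1). Moreover the bound is sharp: it is attained for an admissible choice of (x,y,z) with two of the coordinates zero. (This is the linear-programming core of Proposition 5.1: for an exchangeable random partition Π_{n+1} of {1,…,n+1}, taking x = p(3,1^{n−2}), y = p(2,2,1^{n−3}), z = p(2,1^{n−1}) for the EPPF p, one gets P(K_n(Π_{n+1}) = n−1) ≤ max(4, n−1)/(n+1).) -/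
theorem three_mul_cast_choose_three {n : ℕ} (hn : 2 ≤ n) :
    3 * (n.choose 3 : ℝ) = n.choose 2 * ((n : ℝ) - 2) := by
  have h := Nat.choose_succ_right_eq n 2
  have h' := congrArg (Nat.cast : ℕ → ℝ) h
  push_cast [Nat.cast_sub hn] at h'
  linarith

theorem twelve_mul_cast_choose_four {n : ℕ} (hn : 3 ≤ n) :
    12 * (n.choose 4 : ℝ) = n.choose 2 * ((n : ℝ) - 2) * ((n : ℝ) - 3) := by
  have h := Nat.choose_succ_right_eq n 3
  have h' := congrArg (Nat.cast : ℕ → ℝ) h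
  push_cast [Nat.cast_sub hn] at h'
  linear_combination 3 * h' + ((n : ℝ) - 3) * three_mul_cast_choose_three (by omega : 2 ≤ n)

theorem lp_bound_Kn_partitions (n : ℕ) (hn : 3 ≤ n) :
    (∀ x y z : ℝ, 0 ≤ x → 0 ≤ y → 0 ≤ z →
      ((n.choose 2 : ℝ) + (n.choose 3 : ℝ)) * x +
          ((n.choose 2 : ℝ) * ((n : ℝ) - 2) + 3 * (n.choose 4 : ℝ)) * y +
          ((n.choose 2 : ℝ) + (n : ℝ)) * z ≤ 1 →
      (n.choose 2 : ℝ) * (x + ((n : ℝ) - 2) * y + z) ≤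
        max 4 ((n : ℝ) - 1) / ((n : ℝ) + 1)) ∧
    (∃ x y z : ℝ, 0 ≤ x ∧ 0 ≤ y ∧ 0 ≤ z ∧
      ((x = 0 ∧ y = 0) ∨ (x = 0 ∧ z = 0) ∨ (y = 0 ∧ z = 0)) ∧
      ((n.choose 2 : ℝ) + (n.choose 3 : ℝ)) * x +
          ((n.choose 2 : ℝ) * ((n : ℝ) - 2) + 3 * (n.choose 4 : ℝ)) * y +
          ((n.choose 2 : ℝ) + (n : ℝ)) * z ≤ 1 ∧
      (n.choose 2 : ℝ) * (x + ((n : ℝ) - 2) * y + z) =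
        max 4 ((n : ℝ) - 1) / ((n : ℝ) + 1)) := by
  have h2 := Nat.cast_choose_two ℝ n
  have h3 := three_mul_cast_choose_three (by omega : 2 ≤ n)
  have h4 := twelve_mul_cast_choose_four hn
  have hn' : (3 : ℝ) ≤ n := by exact_mod_cast hn
  generalize (n.choose 2 : ℝ) = c at *
  generalize (n.choose 3 : ℝ) = d at *
  generalize (n.choose 4 : ℝ) = e at *
  generalize (n : ℝ) = t at *
  have ht1 : 0 < t - 1 := by linarith
  have ht2 : 0 < t - 2 := by linarith
  have htp : 0 < t + 1 := by linarith
  have hc : 0 < c := by rw [h2]; exact div_pos (mul_pos (by linarith) ht1) two_pos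
  have hx : 3 * (c + d) = (t + 1) * c := by linear_combination h3
  have hy : 4 * (c * (t - 2) + 3 * e) = (t + 1) * (c * (t - 2)) := by linear_combination h4
  have hz : (t - 1) * (c + t) = (t + 1) * c := by rw [h2]; ring
  have hd : 0 < c + d := by linarith [mul_pos htp hc]
  have he : 0 < c * (t - 2) + 3 * e := by linarith [mul_pos htp (mul_pos hc ht2)]
  have hf : 0 < c + t := by linarith
  refine ⟨fun x y z hx0 hy0 hz0 h => ?_, ?_⟩
  · have hM4 := le_max_left 4 (t - 1)
    have hMt := le_max_right 4 (t - 1)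
    set M := max 4 (t - 1)
    rw [le_div_iff₀ htp]
    have bx : 3 * ((c + d) * x) ≤ M * ((c + d) * x) := by gcongr; linarith
    have bY : 4 * ((c * (t - 2) + 3 * e) * y) ≤ M * ((c * (t - 2) + 3 * e) * y) := by gcongr
    have bz : (t - 1) * ((c + t) * z) ≤ M * ((c + t) * z) := by gcongr
    calc c * (x + (t - 2) * y + z) * (t + 1)
        = 3 * ((c + d) * x) + 4 * ((c * (t - 2) + 3 * e) * y) + (t - 1) * ((c + t) * z) := by
          linear_combination -x * hx - y * hy - z * hz
      _ ≤ M * ((c + d) * x + (c * (t - 2) + 3 * e) * y + (c + t) * z) := by linarith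
      _ ≤ M * 1 := by gcongr
      _ = M := mul_one M
  · rcases le_total (t - 1) 4 with h | h
    · refine ⟨0, 1 / (c * (t - 2) + 3 * e), 0, le_rfl, by positivity, le_rfl,
        Or.inr (Or.inl ⟨rfl, rfl⟩), ?_, ?_⟩
      · simp [he.ne']
      · rw [max_eq_left h]
        field_simp
        linear_combination -hy
    · refine ⟨0, 0, 1 / (c + t), le_rfl, le_rfl, by positivity, Or.inl ⟨rfl, rfl⟩, ?_, ?_⟩
      · simp [hf.ne']
      · rw [max_eq_right h]
        field_simp
        linear_combination -hz
end

section
/- Let m ≥ 0 and θ be real numbers with (m+1)θ > −m and m(1+θ) < 1. Define q₁^{(m)}(t) = (1−m−mt)(2−m−mt)/((1+t)(2+t)) and q₃^{(m)}(t) = (m+(m+1)t)(2m+(2m+1)t)/((1+t)(2+t)), and let θ* = (2 − m(3+m)(1+θ))/(θ + m(3+m)(1+θ)). Then the denominator θ + m(3+m)(1+θ) is positive, θ* also satisfies (m+1)θ* > −m and m(1+θ*) < 1, and q₁^{(m)}(θ*) = q₃^{(m)}(θ) and q₃^{(m)}(θ*) = q₁^{(m)}(θ). (Theorem 6.1: m-duality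 for the two-parameter Chinese restaurant process.) -/
theorem m_duality (m θ : ℝ) (hm : 0 ≤ m)
    (h1 : (m + 1) * θ > -m) (h2 : m * (1 + θ) < 1) :
    0 < θ + m * (3 + m) * (1 + θ) ∧
    (m + 1) * ((2 - m * (3 + m) * (1 + θ)) / (θ + m * (3 + m) * (1 + θ))) > -m ∧
    m * (1 + (2 - m * (3 + m) * (1 + θ)) / (θ + m * (3 + m) * (1 + θ))) < 1 ∧
    (1 - m - m * ((2 - m * (3 + m) * (1 + θ)) / (θ + m * (3 + m) * (1 + θ)))) *
        (2 - m - m * ((2 - m * (3 + m) * (1 + θ)) / (θ + m * (3 + m) * (1 + θ)))) /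
        ((1 + (2 - m * (3 + m) * (1 + θ)) / (θ + m * (3 + m) * (1 + θ))) *
          (2 + (2 - m * (3 + m) * (1 + θ)) / (θ + m * (3 + m) * (1 + θ)))) =
      (m + (m + 1) * θ) * (2 * m + (2 * m + 1) * θ) / ((1 + θ) * (2 + θ)) ∧
    (m + (m + 1) * ((2 - m * (3 + m) * (1 + θ)) / (θ + m * (3 + m) * (1 + θ)))) *
        (2 * m + (2 * m + 1) * ((2 - m * (3 + m) * (1 + θ)) / (θ + m * (3 + m) * (1 + θ)))) /
        ((1 + (2 - m * (3 + m) * (1 + θ)) / (θ + m * (3 + m) * (1 + θ))) *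
          (2 + (2 - m * (3 + m) * (1 + θ)) / (θ + m * (3 + m) * (1 + θ)))) =
      (1 - m - m * θ) * (2 - m - m * θ) / ((1 + θ) * (2 + θ)) := by
  have hs : 0 < 1 + θ := by
    by_contra! h
    nlinarith [mul_nonneg hm (neg_nonneg.mpr h)]
  have hD : 0 < θ + m * (3 + m) * (1 + θ) := by
    nlinarith [mul_nonneg hm hs.le, mul_nonneg (mul_nonneg hm hm) hs.le]
  have e1 : 1 + (2 - m * (3 + m) * (1 + θ)) / (θ + m * (3 + m) * (1 + θ)) =
      (2 + θ) / (θ + m * (3 + m) * (1 + θ)) := by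
    field_simp
    ring
  generalize hx : (2 - m * (3 + m) * (1 + θ)) / (θ + m * (3 + m) * (1 + θ)) = x at e1 ⊢
  generalize hd : θ + m * (3 + m) * (1 + θ) = D at *
  have hx' : x = (2 + θ) / D - 1 := by linarith
  have e2 : 2 + x = (1 + θ) * (1 + m) * (2 + m) / D := by
    rw [hx']; field_simp; rw [← hd]; ring
  have e3 : 1 - m - m * x = (1 + m) * (m + (m + 1) * θ) / D := by
    rw [hx']; field_simp; rw [← hd]; ring
  have e4 : 2 - m - m * x = (2 + m) * (2 * m + (2 * m + 1) * θ) / D := by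
    rw [hx']; field_simp; rw [← hd]; ring
  have e5 : m + (m + 1) * x = (2 + m) * (1 - m - m * θ) / D := by
    rw [hx']; field_simp; rw [← hd]; ring
  have e6 : 2 * m + (2 * m + 1) * x = (1 + m) * (2 - m - m * θ) / D := by
    rw [hx']; field_simp; rw [← hd]; ring
  have hs2 : 0 < 2 + θ := by linarith
  refine ⟨hD, ?_, ?_, ?_, ?_⟩
  · have : 0 < (2 + m) * (1 - m - m * θ) / D :=
      div_pos (mul_pos (by linarith) (by linarith)) hD
    linarith
  · have : 0 < (1 + m) * (m + (m + 1) * θ) / D :=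
      div_pos (mul_pos (by linarith) (by linarith)) hD
    linarith
  · rw [e1, e2, e3, e4]
    field_simp
  · rw [e1, e2, e5, e6]
    field_simp
end

section
/- Let m ≥ 0 and θ be real numbers with (1+θ)(2+θ) ≠ 0, and set q₁ = (1−m−mθ)(2−m−mθ)/((1+θ)(2+θ)) and q₃ = (m+(m+1)θ)(2m+(2m+1)θ)/((1+θ)(2+θ)). Then (4+3m)(q₁+q₃) + 5q₁q₃ − 2(q₁² + q₃²) − 2 − 3m = 0. In particular, for m = 0 (the Ewens family) the pair (q₁,q₃) lies on the symmetric curve h(q₁,q₃) := 4(q₁+q₃) + 5q₁q₃ − 2(q₁²+q₃²) − 2 = 0. -/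
theorem symmetric_curve_identity (m θ : ℝ) (h : (1 + θ) * (2 + θ) ≠ 0) :
    (4 + 3 * m) *
          ((1 - m - m * θ) * (2 - m - m * θ) / ((1 + θ) * (2 + θ)) +
            (m + (m + 1) * θ) * (2 * m + (2 * m + 1) * θ) / ((1 + θ) * (2 + θ))) +
        5 * ((1 - m - m * θ) * (2 - m - m * θ) / ((1 + θ) * (2 + θ))) *
          ((m + (m + 1) * θ) * (2 * m + (2 * m + 1) * θ) / ((1 + θ) * (2 + θ))) -
        2 * (((1 - m - m * θ) * (2 - m - m * θ) / ((1 + θ) * (2 + θ))) ^ 2 +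
          ((m + (m + 1) * θ) * (2 * m + (2 * m + 1) * θ) / ((1 + θ) * (2 + θ))) ^ 2) -
        2 - 3 * m = 0 := by
  have h₁ : 1 + θ ≠ 0 := left_ne_zero_of_mul h
  have h₂ : 2 + θ ≠ 0 := right_ne_zero_of_mul h
  field_simp
  ring
end
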